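/- Let n be a positive integer and let r be a positive even integer with 3r ≤ 2n. Then there exists a triangle-free subset S of the r-distance graph of the n-dimensional hypercube with |S| ≥ (2√2/3) · 2^n / (e^r · 2^(r/2) · (n/r)^(3r/4)), where e is Euler's number and the right-hand side is interpreted as a real number. -/

import Mathlib

open Finset in
/-- First-moment argument: a Bernoulli random subset is at least as good as its expectation. -/
lemma exists_good_subset {V : Type*} [Fintype V] [DecidableEq V] (F : Finset (Finset V))
    (hF : ∀ A ∈ F, A.card = 3) (p : ℝ) (hp0 : 0 ≤ p) (hp1 : p ≤ 1) :
    ∃ S : Finset V, p * Fintype.card V - p ^ 3 * F.card ≤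
      (S.card : ℝ) - ((F.filter (fun A => A ⊆ S)).card : ℝ) := by
  let W : Finset V → ℝ := fun S => (∏ i ∈ S, p) * ∏ i ∈ univ \ S, (1 - p)
  have hW0 : ∀ S, 0 ≤ W S := fun S =>
    mul_nonneg (prod_nonneg fun _ _ => hp0) (prod_nonneg fun _ _ => by linarith)
  have key : ∀ A : Finset V, ∑ S : Finset V, W S * (if A ⊆ S then 1 else 0) = p ^ A.card := by
    intro A
    have h := Finset.prod_add (fun _ : V => p) (fun i => if i ∈ A then 0 else 1 - p) univ
    have hl : ∏ i : V, (p + if i ∈ A then 0 else 1 - p) = p ^ A.card := by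
      have : ∀ i : V, (p + if i ∈ A then 0 else 1 - p) = if i ∈ A then p else 1 := by
        intro i; split_ifs <;> ring
      simp only [this, prod_ite_mem, univ_inter, prod_const]
    rw [← hl, h, powerset_univ]
    refine sum_congr rfl fun S _ => ?_
    split_ifs with hAS
    · rw [mul_one]
      show _ * _ = _ * _
      congr 1
      refine prod_congr rfl fun i hi => ?_
      rw [if_neg]
      intro hiA
      exact (mem_sdiff.1 hi).2 (hAS hiA)
    · obtain ⟨i, hiA, hiS⟩ := not_subset.1 hAS
      have hz : ∏ i ∈ univ \ S, (if i ∈ A then 0 else 1 - p) = 0 :=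
        prod_eq_zero (i := i) (by simp [hiS]) (by simp [hiA])
      rw [mul_zero, hz, mul_zero]
  have hsum1 : ∑ S : Finset V, W S = 1 := by
    have := key ∅
    simpa using this
  have hcard : ∑ S : Finset V, W S * (S.card : ℝ) = p * Fintype.card V := by
    have : ∀ S : Finset V, (S.card : ℝ) = ∑ v : V, if {v} ⊆ S then (1:ℝ) else 0 := by
      intro S; simp
    simp only [this, mul_sum]
    rw [sum_comm]
    simp only [key]
    simp [mul_comm]
  have hFc : ∑ S : Finset V, W S * ((F.filter (fun A => A ⊆ S)).card : ℝ) = p ^ 3 * F.card := by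
    have : ∀ S : Finset V, ((F.filter (fun A => A ⊆ S)).card : ℝ)
        = ∑ A ∈ F, if A ⊆ S then (1:ℝ) else 0 := by
      intro S; simp
    simp only [this, mul_sum]
    rw [sum_comm]
    simp only [key]
    rw [sum_congr rfl (fun A hA => by rw [hF A hA])]
    simp [mul_comm]
  by_contra! hcon
  set c := p * Fintype.card V - p ^ 3 * F.card with hc
  have h1 : ∑ S : Finset V, W S * ((S.card : ℝ) - ((F.filter (fun A => A ⊆ S)).card : ℝ)) = c := by
    simp only [mul_sub, sum_sub_distrib, hcard, hFc, hc]
  have h2 : ∑ S : Finset V, W S * c = c := by rw [← sum_mul, hsum1, one_mul]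
  have h3 : ∑ S : Finset V, W S *
      (c - ((S.card : ℝ) - ((F.filter (fun A => A ⊆ S)).card : ℝ))) = 0 := by
    simp only [mul_sub _ c, sum_sub_distrib, h1, h2, sub_self]
  rw [sum_eq_zero_iff_of_nonneg
    (fun S _ => mul_nonneg (hW0 S) (by linarith [hcon S]))] at h3
  have h4 : ∀ S, W S = 0 := fun S => by
    have := h3 S (mem_univ _)
    rcases mul_eq_zero.1 this with h | h
    · exact h
    · linarith [hcon S]
  simp [h4] at hsum1

open Finset in
/-- Deletion method. -/
lemma exists_subset_avoiding {V : Type*} [Fintype V] [DecidableEq V] (F : Finset (Finset V))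
    (hF : ∀ A ∈ F, A.card = 3) (p : ℝ) (hp0 : 0 ≤ p) (hp1 : p ≤ 1) :
    ∃ S : Finset V, (∀ A ∈ F, ¬ A ⊆ S) ∧
      p * Fintype.card V - p ^ 3 * F.card ≤ (S.card : ℝ) := by
  obtain ⟨S, hS⟩ := exists_good_subset F hF p hp0 hp1
  have hne : ∀ A : Finset V, ∃ x : Option V, A ∈ F → ∃ v ∈ A, x = some v := by
    intro A
    by_cases hA : A ∈ F
    · have : A.Nonempty := by rw [← card_pos, hF A hA]; norm_num
      obtain ⟨v, hv⟩ := this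
      exact ⟨some v, fun _ => ⟨v, hv, rfl⟩⟩
    · exact ⟨none, fun h => absurd h hA⟩
  choose f hf using hne
  let R : Finset (Option V) := (F.filter (fun A => A ⊆ S)).image f
  refine ⟨S.filter (fun v => some v ∉ R), ?_, ?_⟩
  · intro A hA hAS
    obtain ⟨v, hvA, hv⟩ := hf A hA
    have := (mem_filter.1 (hAS hvA)).2
    apply this
    rw [← hv]
    exact mem_image_of_mem _ (mem_filter.2 ⟨hA, fun x hx => (mem_filter.1 (hAS hx)).1⟩)
  · refine hS.trans ?_
    have h1 := card_filter_add_card_filter_not (s := S) (fun v => some v ∈ R)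
    have h2 : (S.filter (fun v => some v ∈ R)).card ≤ R.card := by
      apply card_le_card_of_injOn some
      · intro v hv
        exact (mem_filter.1 hv).2
      · intro a _ b _ h
        simpa using h
    have h3 : R.card ≤ (F.filter (fun A => A ⊆ S)).card := card_image_le
    have h4 : S.card ≤ (F.filter (fun A => A ⊆ S)).card
      + (S.filter (fun v => some v ∉ R)).card := by omega
    have h5 : (S.card : ℝ) ≤ ((F.filter (fun A => A ⊆ S)).card : ℝ)
      + ((S.filter (fun v => some v ∉ R)).card : ℝ) := by exact_mod_cast h4
    linarith

open Finset in
/-- Ordered triangles. -/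
lemma ordered_triangles_card (n m : ℕ) :
    ((univ : Finset ((Fin n → Bool) × (Fin n → Bool) × (Fin n → Bool))).filter
      (fun t => hammingDist t.1 t.2.1 = 2 * m ∧ hammingDist t.1 t.2.2 = 2 * m ∧
        hammingDist t.2.1 t.2.2 = 2 * m)).card ≤ 2 ^ n * (n.choose m) ^ 3 := by
  let P : Finset (Finset (Fin n)) := powersetCard m univ
  have hT : ((univ : Finset (Fin n → Bool)) ×ˢ (P ×ˢ (P ×ˢ P))).card = 2 ^ n * (n.choose m) ^ 3 := by
    simp only [card_product, P, card_powersetCard, card_univ, Fintype.card_fun, Fintype.card_bool,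
      Fintype.card_fin]
    ring
  rw [← hT]
  apply card_le_card_of_injOn (fun t => (t.1,
    (univ.filter (fun i => t.2.1 i ≠ t.1 i ∧ t.2.2 i = t.1 i),
     univ.filter (fun i => t.2.1 i ≠ t.1 i ∧ t.2.2 i ≠ t.1 i),
     univ.filter (fun i => t.2.1 i = t.1 i ∧ t.2.2 i ≠ t.1 i))))
  · rintro ⟨u, v, w⟩ ht
    simp only [coe_filter, mem_univ, true_and, Set.mem_ofPred_eq, hammingDist] at ht
    obtain ⟨h1, h2, h3⟩ := ht
    have e1 : (univ.filter (fun i => v i ≠ u i ∧ w i = u i)).card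
        + (univ.filter (fun i => v i ≠ u i ∧ w i ≠ u i)).card = 2 * m := by
      rw [← h1]
      simp only [card_filter, ← sum_add_distrib]
      refine sum_congr rfl fun i _ => ?_
      cases u i <;> cases v i <;> cases w i <;> simp
    have e2 : (univ.filter (fun i => v i = u i ∧ w i ≠ u i)).card
        + (univ.filter (fun i => v i ≠ u i ∧ w i ≠ u i)).card = 2 * m := by
      rw [← h2]
      simp only [card_filter, ← sum_add_distrib]
      refine sum_congr rfl fun i _ => ?_
      cases u i <;> cases v i <;> cases w i <;> simp
    have e3 : (univ.filter (fun i => v i = u i ∧ w i ≠ u i)).card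
        + (univ.filter (fun i => v i ≠ u i ∧ w i = u i)).card = 2 * m := by
      rw [← h3]
      simp only [card_filter, ← sum_add_distrib]
      refine sum_congr rfl fun i _ => ?_
      cases u i <;> cases v i <;> cases w i <;> simp
    simp only [P, coe_product, Set.mem_prod, mem_coe, mem_univ, mem_powersetCard, subset_univ,
      true_and]
    refine ⟨?_, ?_, ?_⟩ <;> omega
  · rintro ⟨u, v, w⟩ _ ⟨u', v', w'⟩ _ h
    simp only [Prod.mk.injEq] at h
    obtain ⟨rfl, h1, h2, h3⟩ := h
    have k : ∀ i, v i = v' i ∧ w i = w' i := by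
      intro i
      have a1 := Finset.ext_iff.1 h1 i
      have a2 := Finset.ext_iff.1 h2 i
      have a3 := Finset.ext_iff.1 h3 i
      simp only [mem_filter, mem_univ, true_and] at a1 a2 a3
      revert a1 a2 a3
      cases u i <;> cases v i <;> cases w i <;> cases v' i <;> cases w' i <;> simp
    have kv : v = v' := funext fun i => (k i).1
    have kw : w = w' := funext fun i => (k i).2
    rw [kv, kw]

open Finset in
lemma triangles_card (n m : ℕ) (F : Finset (Finset (Fin n → Bool)))
    (hF : ∀ A ∈ F, A.card = 3 ∧ ∀ u ∈ A, ∀ v ∈ A, u ≠ v → hammingDist u v = 2 * m) :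
    6 * F.card ≤ 2 ^ n * (n.choose m) ^ 3 := by
  refine le_trans ?_ (ordered_triangles_card n m)
  set T := ((univ : Finset ((Fin n → Bool) × (Fin n → Bool) × (Fin n → Bool))).filter
      (fun t => hammingDist t.1 t.2.1 = 2 * m ∧ hammingDist t.1 t.2.2 = 2 * m ∧
        hammingDist t.2.1 t.2.2 = 2 * m)) with hTdef
  let g : (Fin n → Bool) × (Fin n → Bool) × (Fin n → Bool) → Finset (Fin n → Bool) :=
    fun t => {t.1, t.2.1, t.2.2}
  have h1 : ∑ A ∈ F, (T.filter (fun t => g t = A)).card ≤ T.card := by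
    rw [← card_biUnion]
    · apply card_le_card
      intro t ht
      obtain ⟨A, _, hA⟩ := mem_biUnion.1 ht
      exact (mem_filter.1 hA).1
    · intro A _ B _ hAB
      refine disjoint_left.2 fun t h1 h2 => hAB ?_
      rw [← (mem_filter.1 h1).2, (mem_filter.1 h2).2]
  refine le_trans ?_ h1
  rw [mul_comm, ← smul_eq_mul]
  apply card_nsmul_le_sum
  intro A hA
  obtain ⟨hc, hd⟩ := hF A hA
  obtain ⟨a, b, c, hab, hac, hbc, rfl⟩ := card_eq_three.1 hc
  have hsix : ({(a,b,c),(a,c,b),(b,a,c),(b,c,a),(c,a,b),(c,b,a)} :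
      Finset ((Fin n → Bool) × (Fin n → Bool) × (Fin n → Bool))).card = 6 := by
    have := hab.symm
    have := hac.symm
    have := hbc.symm
    repeat rw [card_insert_of_notMem (by simp [*])]
    simp
  rw [← hsix]
  apply card_le_card
  have dab := hd a (by simp) b (by simp) hab
  have dac := hd a (by simp) c (by simp) hac
  have dbc := hd b (by simp) c (by simp) hbc
  have dba := hammingDist_comm a b ▸ dab
  have dca := hammingDist_comm a c ▸ dac
  have dcb := hammingDist_comm b c ▸ dbc
  intro t ht
  simp only [mem_insert, mem_singleton] at ht
  have mk : ∀ x y z : Fin n → Bool, hammingDist x y = 2 * m → hammingDist x z = 2 * m →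
      hammingDist y z = 2 * m → ({x, y, z} : Finset (Fin n → Bool)) = {a, b, c} →
      (x, y, z) ∈ T.filter (fun t => g t = {a, b, c}) := by
    intro x y z h1 h2 h3 h4
    exact mem_filter.2 ⟨mem_filter.2 ⟨mem_univ _, h1, h2, h3⟩, h4⟩
  rcases ht with rfl | rfl | rfl | rfl | rfl | rfl
  · exact mk _ _ _ dab dac dbc rfl
  · exact mk _ _ _ dac dab dcb (by grind)
  · exact mk _ _ _ dba dbc dac (by grind)
  · exact mk _ _ _ dbc dba dca (by grind)
  · exact mk _ _ _ dca dcb dab (by grind)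
  · exact mk _ _ _ dcb dca dba (by grind)

lemma choose_bound (n m : ℕ) (hm : 0 < m) :
    (n.choose m : ℝ) ≤ ((n : ℝ) / m) ^ m * Real.exp m := by
  have hm' : (0:ℝ) < m := by exact_mod_cast hm
  have h1 : (n.choose m : ℝ) ≤ (n : ℝ) ^ m / (m.factorial : ℝ) := Nat.choose_le_pow_div m n
  have h2 : (m : ℝ) ^ m / (m.factorial : ℝ) ≤ Real.exp m :=
    Real.pow_div_factorial_le_exp _ hm'.le _
  refine h1.trans ?_
  have : (n : ℝ) ^ m / (m.factorial : ℝ) = ((n : ℝ) / m) ^ m * ((m : ℝ) ^ m / (m.factorial : ℝ)) := by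
    rw [div_pow]; field_simp
  rw [this]
  gcongr

/-- asymptotic form of the probabilistic lower bound: there is a
triangle-free subset of the `r`-distance graph of the hypercube of size at least
`(2√2/3) · 2^n / (e^r · 2^(r/2) · (n/r)^(3r/4))`. -/
theorem exists_triangle_free_subset_asymptotic_lower_bound
    (n r : ℕ) (hn : 0 < n) (hr : 0 < r) (hre : Even r) (hrn : 3 * r ≤ 2 * n) :
    ∃ S : Finset (Fin n → Bool),
      (∀ u ∈ S, ∀ v ∈ S, ∀ w ∈ S, u ≠ v → u ≠ w → v ≠ w →
        ¬(hammingDist u v = r ∧ hammingDist u w = r ∧ hammingDist v w = r)) ∧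
      (S.card : ℝ) ≥ (2 * Real.sqrt 2 / 3) * 2 ^ n /
        (Real.exp r * 2 ^ (r / 2) * ((n : ℝ) / r) ^ (3 * (r : ℝ) / 4)) := by
  classical
  obtain ⟨m, hm⟩ := hre
  have hm2 : r = 2 * m := by omega
  have hm0 : 0 < m := by omega
  have hm' : (0:ℝ) < m := by exact_mod_cast hm0
  have hr' : (0:ℝ) < r := by exact_mod_cast hr
  have hrm : (r : ℝ) = 2 * m := by rw [hm2]; push_cast; ring
  set x : ℝ := (n : ℝ) / r with hx
  have hx1 : 1 ≤ x := by
    rw [hx, one_le_div hr']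
    exact_mod_cast (by omega : r ≤ n)
  have hx0 : 0 < x := by linarith
  set Q : ℝ := Real.exp r * 2 ^ (r / 2) * x ^ (3 * (r : ℝ) / 4) with hQ
  have hQ0 : 0 < Q := by positivity
  have hQ2 : 2 ≤ Q := by
    have a1 : (2:ℝ) ≤ Real.exp r := by
      have := Real.add_one_le_exp (r : ℝ)
      have : (1:ℝ) ≤ r := by exact_mod_cast hr
      linarith
    have a2 : (1:ℝ) ≤ 2 ^ (r / 2) := one_le_pow₀ (by norm_num)
    have a3 : (1:ℝ) ≤ x ^ (3 * (r : ℝ) / 4) := Real.one_le_rpow hx1 (by positivity)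
    calc (2:ℝ) = 2 * 1 * 1 := by norm_num
      _ ≤ Q := by rw [hQ]; gcongr
  have hQsq : Q ^ 2 = Real.exp m ^ 4 * (4 ^ m * x ^ (3 * m)) := by
    have b1 : Real.exp r = Real.exp m ^ 2 := by
      rw [← Real.exp_nat_mul, hrm]; norm_num
    have b2 : r / 2 = m := by omega
    have b3 : (x ^ (3 * (r : ℝ) / 4)) ^ 2 = x ^ (3 * m) := by
      rw [← Real.rpow_natCast, ← Real.rpow_mul hx0.le, ← Real.rpow_natCast, hrm]
      congr 1; push_cast; ring
    rw [hQ, mul_pow, mul_pow, b3, b1, b2, ← pow_mul (2:ℝ), mul_comm m 2, pow_mul (2:ℝ)]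
    norm_num
    ring
  have hC : (n.choose m : ℝ) ^ 3 ≤ Q ^ 2 := by
    have c1 := choose_bound n m hm0
    have c2 : (n : ℝ) / m = 2 * x := by rw [hx, hrm]; field_simp
    rw [c2] at c1
    have c3 : (2:ℝ) ^ m ≤ Real.exp m := by
      have : Real.exp m = Real.exp 1 ^ m := by rw [← Real.exp_nat_mul, mul_one]
      rw [this]
      have := Real.add_one_le_exp (1 : ℝ)
      gcongr
      linarith
    calc (n.choose m : ℝ) ^ 3 ≤ ((2 * x) ^ m * Real.exp m) ^ 3 := by gcongr
      _ = 2 ^ m * (Real.exp m ^ 3 * (4 ^ m * x ^ (3 * m))) := by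
        have : (4:ℝ) ^ m = 2 ^ m * 2 ^ m := by rw [← mul_pow]; norm_num
        rw [this, mul_pow, mul_pow, mul_pow, mul_comm 3 m, pow_mul x]; ring
      _ ≤ Real.exp m * (Real.exp m ^ 3 * (4 ^ m * x ^ (3 * m))) := by gcongr
      _ = Q ^ 2 := by rw [hQsq]; ring
  let F : Finset (Finset (Fin n → Bool)) := Finset.univ.filter
    (fun A => A.card = 3 ∧ ∀ u ∈ A, ∀ v ∈ A, u ≠ v → hammingDist u v = 2 * m)
  have hF : ∀ A ∈ F, A.card = 3 ∧ ∀ u ∈ A, ∀ v ∈ A, u ≠ v → hammingDist u v = 2 * m :=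
    fun A hA => (Finset.mem_filter.1 hA).2
  have hFc : 6 * (F.card : ℝ) ≤ 2 ^ n * Q ^ 2 := by
    have h := triangles_card n m F hF
    have h' : 6 * (F.card : ℝ) ≤ 2 ^ n * (n.choose m : ℝ) ^ 3 := by exact_mod_cast h
    refine h'.trans ?_
    gcongr
  have hs2 : Real.sqrt 2 ^ 2 = 2 := Real.sq_sqrt (by norm_num)
  have hs0 : 0 ≤ Real.sqrt 2 := Real.sqrt_nonneg _
  have hs : Real.sqrt 2 ≤ 2 := by nlinarith
  set p : ℝ := Real.sqrt 2 / Q with hp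
  have hp0 : 0 ≤ p := by positivity
  have hp1 : p ≤ 1 := by rw [hp, div_le_one hQ0]; linarith
  obtain ⟨S, hS1, hS2⟩ := exists_subset_avoiding F (fun A hA => (hF A hA).1) p hp0 hp1
  refine ⟨S, ?_, ?_⟩
  · rintro u hu v hv w hw huv huw hvw ⟨d1, d2, d3⟩
    rw [hm2] at d1 d2 d3
    have d1' := hammingDist_comm u v ▸ d1
    have d2' := hammingDist_comm u w ▸ d2
    have d3' := hammingDist_comm v w ▸ d3
    refine hS1 {u, v, w} ?_ ?_
    · simp only [F, Finset.mem_filter, Finset.mem_univ, true_and]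
      refine ⟨Finset.card_eq_three.2 ⟨u, v, w, huv, huw, hvw, rfl⟩, ?_⟩
      intro a ha b hb hab
      simp only [Finset.mem_insert, Finset.mem_singleton] at ha hb
      rcases ha with rfl | rfl | rfl <;> rcases hb with rfl | rfl | rfl <;>
        first | exact absurd rfl hab | assumption
    · intro a ha
      simp only [Finset.mem_insert, Finset.mem_singleton] at ha
      rcases ha with rfl | rfl | rfl <;> assumption
  · have hN : (Fintype.card (Fin n → Bool) : ℝ) = 2 ^ n := by simp
    rw [hN] at hS2
    refine ge_trans hS2 ?_
    have hpQ : p ^ 2 * Q ^ 2 = 2 := by rw [hp, div_pow, hs2]; field_simp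
    have e1 : p ^ 3 * (F.card : ℝ) ≤ p * 2 ^ n / 3 := by
      calc p ^ 3 * (F.card : ℝ) = p ^ 3 / 6 * (6 * F.card) := by ring
        _ ≤ p ^ 3 / 6 * (2 ^ n * Q ^ 2) := by gcongr
        _ = p * 2 ^ n / 6 * (p ^ 2 * Q ^ 2) := by ring
        _ = p * 2 ^ n / 3 := by rw [hpQ]; ring
    have e2 : (2 * Real.sqrt 2 / 3) * 2 ^ n / Q = 2 / 3 * (p * 2 ^ n) := by rw [hp]; ring
    rw [e2]
    linarith
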